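/- arXiv:1708.03159 — 2 statements merged into one kernel-verified Lean document; each statement's English description precedes it below -/
import Mathlib

section
/- Fix b ∈ ℝ, z ≥ 0 and a Borel measure ν on ℝ \ {0} with ∫_ℝ min(y², 1) ν(dy) < ∞, and define η(p) = i b p − (z/2) p² + ∫_ℝ ( e^{ipy} − 1 − i p y · 1_{[−1,1]}(y) ) ν(dy) for p ∈ ℝ. Then for every f ∈ 𝒮(ℝ) and every x ∈ ℝ, (2π)^{-1/2} ∫_ℝ e^{ipx} η(p) f̂(p) dp = (z/2) f''(x) + b f'(x) + ∫_ℝ [ f(x+y) − f(x) − y f'(x) · 1_{{|y|≤1}}(y) ] ν(dy), where all integrals converge absolutely. -/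
open MeasureTheory Complex Real Filter

/-- Fourier transform with the `(2π)^{-1/2}` normalization. -/
noncomputable def fhat (f : ℝ → ℂ) (p : ℝ) : ℂ :=
  (Real.sqrt (2 * Real.pi))⁻¹ * ∫ x : ℝ, Complex.exp (-(Complex.I * p * x)) * f x

open scoped FourierTransform SchwartzMap

lemma fhat_eq_fourier (f : ℝ → ℂ) (p : ℝ) :
    fhat f p = ((Real.sqrt (2 * Real.pi))⁻¹ : ℝ) * 𝓕 f (p / (2 * Real.pi)) := by
  rw [fhat, Real.fourier_real_eq_integral_exp_smul]
  congr 1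
  refine integral_congr_ae (Eventually.of_forall fun v => ?_)
  have hpi : (Real.pi : ℂ) ≠ 0 := by exact_mod_cast Real.pi_ne_zero
  simp only [smul_eq_mul]
  congr 2
  push_cast
  field_simp

lemma continuous_fhat (f : 𝓢(ℝ, ℂ)) : Continuous (fhat ⇑f) := by
  have h : fhat ⇑f = fun p : ℝ =>
      (((Real.sqrt (2 * Real.pi))⁻¹ : ℝ) : ℂ) * (𝓕 f) (p / (2 * Real.pi)) := by
    funext p
    rw [fhat_eq_fourier, SchwartzMap.fourier_coe]
  rw [h]
  exact continuous_const.mul ((𝓕 f).continuous.comp (continuous_id.div_const _))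

lemma integrable_pow_mul_norm_fhat (f : 𝓢(ℝ, ℂ)) (k : ℕ) :
    Integrable (fun p : ℝ => |p| ^ k * ‖fhat ⇑f p‖) := by
  have h2 : (2 * Real.pi) ≠ 0 := by positivity
  have h := (((𝓕 f).integrable_pow_mul volume k).comp_div h2).const_mul
    ((2 * Real.pi) ^ k * ‖((Real.sqrt (2 * Real.pi))⁻¹ : ℝ)‖)
  refine h.congr (Eventually.of_forall fun p => ?_)
  simp only
  rw [fhat_eq_fourier, SchwartzMap.fourier_coe, norm_mul, Complex.norm_real, Real.norm_eq_abs (p / _),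
    abs_div, abs_of_pos Real.two_pi_pos, div_pow]
  field_simp

lemma fhat_deriv (f : 𝓢(ℝ, ℂ)) (p : ℝ) :
    fhat (deriv ⇑f) p = Complex.I * p * fhat ⇑f p := by
  have hpi : (Real.pi : ℂ) ≠ 0 := by exact_mod_cast Real.pi_ne_zero
  rw [fhat_eq_fourier, fhat_eq_fourier,
    Real.fourier_deriv f.integrable f.differentiable
      (SchwartzMap.derivCLM ℂ ℂ f).integrable]
  simp only [smul_eq_mul]
  push_cast
  field_simp

lemma integrable_exp_mul_fhat (f : 𝓢(ℝ, ℂ)) (x : ℝ) :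
    Integrable (fun p : ℝ => Complex.exp (Complex.I * p * x) * fhat ⇑f p) := by
  have hc := continuous_fhat f
  refine (integrable_pow_mul_norm_fhat f 0).mono'
    (by fun_prop : Continuous _).aestronglyMeasurable (Eventually.of_forall fun p => ?_)
  rw [norm_mul, mul_assoc, ← Complex.ofReal_mul, Complex.norm_exp_I_mul_ofReal]
  simp

lemma fhat_inversion (f : 𝓢(ℝ, ℂ)) (x : ℝ) :
    (Real.sqrt (2 * Real.pi))⁻¹ * ∫ p : ℝ, Complex.exp (Complex.I * p * x) * fhat ⇑f p = f x := by
  have hpi : (Real.pi : ℂ) ≠ 0 := by exact_mod_cast Real.pi_ne_zero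
  have h1 : ∀ p : ℝ, Complex.exp (Complex.I * p * x) * fhat ⇑f p =
      (fun q : ℝ => ((Real.sqrt (2 * Real.pi))⁻¹ : ℝ) *
        (Complex.exp (↑(2 * Real.pi * q * x) * Complex.I) • 𝓕 ⇑f q)) (p / (2 * Real.pi)) := by
    intro p
    rw [fhat_eq_fourier]
    have : Complex.I * p * x = ↑(2 * Real.pi * (p / (2 * Real.pi)) * x) * Complex.I := by
      push_cast
      field_simp
    simp only [this, smul_eq_mul]
    ring
  have h3 : 𝓕⁻ (𝓕 ⇑f) x = f x := by
    rw [← SchwartzMap.fourier_coe, ← SchwartzMap.fourierInv_coe,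
      FourierTransform.fourierInv_fourier_eq]
  have h4 : 𝓕⁻ (𝓕 ⇑f) x = ∫ q : ℝ, Complex.exp (↑(2 * Real.pi * q * x) * Complex.I) • 𝓕 ⇑f q := by
    rw [Real.fourierInv_eq']
    simp [mul_comm, mul_assoc, mul_left_comm]
  have h5 := (integral_congr_ae (Eventually.of_forall h1)).trans
    (Measure.integral_comp_div (fun q : ℝ => (((Real.sqrt (2 * Real.pi))⁻¹ : ℝ) : ℂ) *
      (Complex.exp (↑(2 * Real.pi * q * x) * Complex.I) • 𝓕 ⇑f q)) (2 * Real.pi))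
  rw [h5, integral_const_mul, ← h4, h3, abs_of_pos Real.two_pi_pos,
    Complex.real_smul]
  have hs : (Real.sqrt (2 * Real.pi)) * (Real.sqrt (2 * Real.pi)) = 2 * Real.pi :=
    Real.mul_self_sqrt Real.two_pi_pos.le
  have hs0 : Real.sqrt (2 * Real.pi) ≠ 0 := by positivity
  have hs1 : (Real.sqrt (2 * Real.pi))⁻¹ * ((2 * Real.pi) * (Real.sqrt (2 * Real.pi))⁻¹) = 1 := by
    field_simp
    rw [sq, hs]
  have hs2 : ((Real.sqrt (2 * Real.pi) : ℝ) : ℂ)⁻¹ *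
      (((2 * Real.pi : ℝ) : ℂ) * ((Real.sqrt (2 * Real.pi) : ℝ) : ℂ)⁻¹) = 1 := by
    exact_mod_cast hs1
  push_cast at hs2 ⊢
  linear_combination f x * hs2

lemma SchwartzMap.coe_derivCLM (f : 𝓢(ℝ, ℂ)) : ⇑(SchwartzMap.derivCLM ℂ ℂ f) = deriv ⇑f := rfl

lemma integrable_exp_mul_fhat_deriv (f : 𝓢(ℝ, ℂ)) (x : ℝ) :
    Integrable (fun p : ℝ => Complex.exp (Complex.I * p * x) * (Complex.I * p * fhat ⇑f p)) := by
  simpa only [SchwartzMap.coe_derivCLM, fhat_deriv] using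
    integrable_exp_mul_fhat (SchwartzMap.derivCLM ℂ ℂ f) x

lemma fhat_inversion_deriv (f : 𝓢(ℝ, ℂ)) (x : ℝ) :
    (Real.sqrt (2 * Real.pi))⁻¹ *
      ∫ p : ℝ, Complex.exp (Complex.I * p * x) * (Complex.I * p * fhat ⇑f p) = deriv ⇑f x := by
  simpa only [SchwartzMap.coe_derivCLM, fhat_deriv] using
    fhat_inversion (SchwartzMap.derivCLM ℂ ℂ f) x

/-- The compensated Lévy–Khintchine integrand `e^{ipy} - 1 - i p y 1_{[-1,1]}(y)`. -/
noncomputable def levyKernel (p y : ℝ) : ℂ :=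
  Complex.exp (Complex.I * p * y) - 1 -
    Set.indicator (Set.Icc (-1 : ℝ) 1) (fun y : ℝ => Complex.I * p * y) y

lemma norm_exp_I_mul_sub_one_sub_le (u : ℝ) :
    ‖Complex.exp (Complex.I * u) - 1 - Complex.I * u‖ ≤ 3 * u ^ 2 := by
  rcases le_total |u| 1 with h | h
  · have h1 : ‖Complex.I * u‖ = |u| := by simp
    have h2 := Complex.norm_exp_sub_one_sub_id_le (x := Complex.I * u) (by rw [h1]; exact h)
    rw [h1, sq_abs] at h2
    nlinarith [sq_nonneg u]
  · have h1 : ‖Complex.I * u‖ = |u| := by simp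
    have h2 : ‖Complex.exp (Complex.I * u) - 1‖ ≤ |u| := Real.norm_exp_I_mul_ofReal_sub_one_le
    have h3 := norm_sub_le (Complex.exp (Complex.I * u) - 1) (Complex.I * u)
    rw [h1] at h3
    nlinarith [sq_abs u]

lemma norm_levyKernel_le (p y : ℝ) :
    ‖levyKernel p y‖ ≤ (2 + 3 * p ^ 2) * min (y ^ 2) 1 := by
  have hu : Complex.I * p * y = Complex.I * ((p * y : ℝ) : ℂ) := by push_cast; ring
  by_cases hy : y ∈ Set.Icc (-1 : ℝ) 1
  · have hm : min (y ^ 2) 1 = y ^ 2 := by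
      apply min_eq_left
      nlinarith [hy.1, hy.2]
    rw [levyKernel, Set.indicator_of_mem hy, hu, hm]
    refine (norm_exp_I_mul_sub_one_sub_le _).trans ?_
    nlinarith [sq_nonneg y]
  · have hm : min (y ^ 2) 1 = 1 := by
      apply min_eq_right
      rw [one_le_sq_iff_one_le_abs]
      by_contra! h
      exact hy (abs_le.mp h.le)
    rw [levyKernel, Set.indicator_of_notMem hy, hu, hm, sub_zero]
    refine (norm_sub_le _ _).trans ?_
    rw [Complex.norm_exp_I_mul_ofReal, norm_one]
    nlinarith [sq_nonneg p]

lemma measurable_levyKernel : Measurable (fun q : ℝ × ℝ => levyKernel q.1 q.2) := by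
  have h : (fun q : ℝ × ℝ => levyKernel q.1 q.2) = fun q : ℝ × ℝ =>
      Complex.exp (Complex.I * q.1 * q.2) - 1 -
        Set.indicator (Prod.snd ⁻¹' Set.Icc (-1 : ℝ) 1)
          (fun q : ℝ × ℝ => Complex.I * q.1 * q.2) q := by
    funext q
    simp only [levyKernel, Set.indicator, Set.mem_preimage]
  rw [h]
  refine Measurable.sub (by fun_prop) (Measurable.indicator (by fun_prop) ?_)
  exact measurable_snd measurableSet_Icc

lemma integrable_min_sq_one {ν : Measure ℝ}
    (hν : ∫⁻ y : ℝ, ENNReal.ofReal (min (y ^ 2) 1) ∂ν < ⊤) :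
    Integrable (fun y : ℝ => min (y ^ 2) 1) ν := by
  refine ⟨(by fun_prop : Measurable _).aestronglyMeasurable, ?_⟩
  rw [hasFiniteIntegral_iff_ofReal (Eventually.of_forall fun y => by positivity)]
  exact hν

/-- A Lévy measure is s-finite. -/
lemma sFinite_of_lintegral_min_sq_one {ν : Measure ℝ} (hν0 : ν {0} = 0)
    (hν : ∫⁻ y : ℝ, ENNReal.ofReal (min (y ^ 2) 1) ∂ν < ⊤) : SFinite ν := by
  have hm : Measurable fun y : ℝ => ENNReal.ofReal (min (y ^ 2) 1) := by fun_prop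
  have := isFiniteMeasure_withDensity hν.ne
  have hne : ∀ᵐ y ∂ν, ENNReal.ofReal (min (y ^ 2) 1) ≠ 0 := by
    have h0 : ∀ᵐ y ∂ν, y ≠ 0 := by
      rw [ae_iff]
      simpa using hν0
    filter_upwards [h0] with y hy
    have : 0 < min (y ^ 2) 1 := by positivity
    exact (ENNReal.ofReal_pos.mpr this).ne'
  rw [← withDensity_inv_same hm hne (Eventually.of_forall fun y => ENNReal.ofReal_ne_top)]
  infer_instance

lemma integrable_exp_mul_levyKernel_mul_fhat {ν : Measure ℝ} [SFinite ν]
    (hν : ∫⁻ y : ℝ, ENNReal.ofReal (min (y ^ 2) 1) ∂ν < ⊤) (f : 𝓢(ℝ, ℂ)) (x : ℝ) :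
    Integrable (Function.uncurry fun p y : ℝ =>
      Complex.exp (Complex.I * p * x) * levyKernel p y * fhat ⇑f p) (volume.prod ν) := by
  have hg : Integrable (fun p : ℝ => (2 + 3 * p ^ 2) * ‖fhat ⇑f p‖) := by
    refine (((integrable_pow_mul_norm_fhat f 0).const_mul 2).add
      ((integrable_pow_mul_norm_fhat f 2).const_mul 3)).congr (Eventually.of_forall fun p => ?_)
    simp only [Pi.add_apply, sq_abs, pow_zero]
    ring
  have hc := (continuous_fhat f).measurable
  refine (hg.mul_prod (integrable_min_sq_one hν)).mono' ?_ (Eventually.of_forall fun q => ?_)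
  · refine Measurable.aestronglyMeasurable ?_
    refine Measurable.mul (Measurable.mul ?_ measurable_levyKernel) (hc.comp measurable_fst)
    fun_prop
  · obtain ⟨p, y⟩ := q
    simp only [Function.uncurry_apply_pair]
    rw [norm_mul, norm_mul, mul_assoc Complex.I, ← Complex.ofReal_mul,
      Complex.norm_exp_I_mul_ofReal, one_mul]
    calc _ ≤ ((2 + 3 * p ^ 2) * min (y ^ 2) 1) * ‖fhat ⇑f p‖ := by
          gcongr
          exact norm_levyKernel_le p y
      _ = _ := by ring

lemma integral_exp_mul_levyKernel_mul_fhat (f : 𝓢(ℝ, ℂ)) (x y : ℝ) :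
    (Real.sqrt (2 * Real.pi))⁻¹ *
      ∫ p : ℝ, Complex.exp (Complex.I * p * x) * levyKernel p y * fhat ⇑f p =
    f (x + y) - f x -
      Set.indicator {y : ℝ | |y| ≤ 1} (fun y : ℝ => (y : ℂ) * deriv (⇑f) x) y := by
  have hset : {y : ℝ | |y| ≤ 1} = Set.Icc (-1 : ℝ) 1 := by
    ext y
    simp [abs_le]
  have hexp : ∀ p : ℝ, Complex.exp (Complex.I * p * (x + y : ℝ)) =
      Complex.exp (Complex.I * p * x) * Complex.exp (Complex.I * p * y) := by
    intro p
    rw [← Complex.exp_add]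
    push_cast
    ring_nf
  have h1 := integrable_exp_mul_fhat f (x + y)
  have h2 := integrable_exp_mul_fhat f x
  have h3 := (integrable_exp_mul_fhat_deriv f x).const_mul
    (Set.indicator (Set.Icc (-1 : ℝ) 1) (fun y : ℝ => (y : ℂ)) y)
  have hdecomp : ∀ p : ℝ, Complex.exp (Complex.I * p * x) * levyKernel p y * fhat ⇑f p =
      Complex.exp (Complex.I * p * (x + y : ℝ)) * fhat ⇑f p -
        Complex.exp (Complex.I * p * x) * fhat ⇑f p -
        Set.indicator (Set.Icc (-1 : ℝ) 1) (fun y : ℝ => (y : ℂ)) y *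
          (Complex.exp (Complex.I * p * x) * (Complex.I * p * fhat ⇑f p)) := by
    intro p
    rw [hexp, levyKernel]
    by_cases hy : y ∈ Set.Icc (-1 : ℝ) 1
    · simp only [Set.indicator_of_mem hy]
      ring
    · simp only [Set.indicator_of_notMem hy]
      ring
  have h12 : Integrable fun p : ℝ => Complex.exp (Complex.I * p * (x + y : ℝ)) * fhat ⇑f p -
      Complex.exp (Complex.I * p * x) * fhat ⇑f p := h1.sub h2
  simp_rw [hdecomp]
  rw [integral_sub h12 h3, integral_sub h1 h2, integral_const_mul, mul_sub, mul_sub,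
    fhat_inversion, fhat_inversion, mul_left_comm, fhat_inversion_deriv, hset]
  by_cases hy : y ∈ Set.Icc (-1 : ℝ) 1
  · simp only [Set.indicator_of_mem hy]
  · simp only [Set.indicator_of_notMem hy, zero_mul]


theorem stmt2
    (b z : ℝ) (hz : 0 ≤ z)
    (ν : Measure ℝ) (hν0 : ν {0} = 0)
    (hνfin : ∫⁻ y : ℝ, ENNReal.ofReal (min (y ^ 2) 1) ∂ν < ⊤)
    (η : ℝ → ℂ)
    (hη : ∀ p : ℝ, η p = Complex.I * b * p - (z / 2) * p ^ 2 +
      ∫ y : ℝ, (Complex.exp (Complex.I * p * y) - 1 -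
        Set.indicator (Set.Icc (-1 : ℝ) 1) (fun y : ℝ => Complex.I * p * y) y) ∂ν)
    (f : SchwartzMap ℝ ℂ) (x : ℝ) :
    Integrable (fun p : ℝ =>
      Complex.exp (Complex.I * p * x) * η p * fhat (⇑f) p) ∧
    Integrable (fun y : ℝ =>
      f (x + y) - f x -
        Set.indicator {y : ℝ | |y| ≤ 1} (fun y : ℝ => (y : ℂ) * deriv (⇑f) x) y) ν ∧
    (Real.sqrt (2 * Real.pi))⁻¹ *
        (∫ p : ℝ, Complex.exp (Complex.I * p * x) * η p * fhat (⇑f) p)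
      = (z / 2 : ℂ) * deriv (deriv (⇑f)) x + (b : ℂ) * deriv (⇑f) x +
        ∫ y : ℝ, (f (x + y) - f x -
          Set.indicator {y : ℝ | |y| ≤ 1} (fun y : ℝ => (y : ℂ) * deriv (⇑f) x) y) ∂ν := by
  have := sFinite_of_lintegral_min_sq_one hν0 hνfin
  have hprod := integrable_exp_mul_levyKernel_mul_fhat hνfin f x
  have h1 := (integrable_exp_mul_fhat_deriv f x).const_mul (b : ℂ)
  have h2 : Integrable (fun p : ℝ => (z / 2 : ℂ) * (Complex.exp (Complex.I * p * x) *
      (Complex.I * p * (Complex.I * p * fhat ⇑f p)))) := by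
    simpa only [SchwartzMap.coe_derivCLM, fhat_deriv] using
      (integrable_exp_mul_fhat_deriv (SchwartzMap.derivCLM ℂ ℂ f) x).const_mul (z / 2 : ℂ)
  have hinv2 : (Real.sqrt (2 * Real.pi))⁻¹ * ∫ p : ℝ, Complex.exp (Complex.I * p * x) *
      (Complex.I * p * (Complex.I * p * fhat ⇑f p)) = deriv (deriv ⇑f) x := by
    simpa only [SchwartzMap.coe_derivCLM, fhat_deriv] using
      fhat_inversion_deriv (SchwartzMap.derivCLM ℂ ℂ f) x
  have h3 : Integrable (fun p : ℝ =>
      ∫ y, Complex.exp (Complex.I * p * x) * levyKernel p y * fhat ⇑f p ∂ν) :=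
    hprod.integral_prod_left
  have hdecomp : (fun p : ℝ => Complex.exp (Complex.I * p * x) * η p * fhat ⇑f p) = fun p : ℝ =>
      (z / 2 : ℂ) * (Complex.exp (Complex.I * p * x) *
        (Complex.I * p * (Complex.I * p * fhat ⇑f p))) +
      (b : ℂ) * (Complex.exp (Complex.I * p * x) * (Complex.I * p * fhat ⇑f p)) +
      ∫ y, Complex.exp (Complex.I * p * x) * levyKernel p y * fhat ⇑f p ∂ν := by
    funext p
    have hk : η p = Complex.I * b * p - (z / 2) * p ^ 2 + ∫ y, levyKernel p y ∂ν := hη p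
    rw [integral_mul_const, integral_const_mul, hk]
    linear_combination (-(z / 2 : ℂ) * Complex.exp (Complex.I * p * x) * p ^ 2 * fhat ⇑f p) *
      Complex.I_sq
  have h21 : Integrable fun p : ℝ => (z / 2 : ℂ) * (Complex.exp (Complex.I * p * x) *
        (Complex.I * p * (Complex.I * p * fhat ⇑f p))) +
      (b : ℂ) * (Complex.exp (Complex.I * p * x) * (Complex.I * p * fhat ⇑f p)) := h2.add h1
  have hinner : ∀ y : ℝ, _ := integral_exp_mul_levyKernel_mul_fhat f x
  refine ⟨?_, ?_, ?_⟩
  · rw [hdecomp]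
    exact h21.add h3
  · simp_rw [← hinner]
    exact hprod.integral_prod_right.const_mul _
  · simp_rw [hdecomp, ← hinner]
    rw [integral_add h21 h3, integral_add h2 h1, integral_const_mul, integral_const_mul,
      integral_const_mul, integral_integral_swap hprod, mul_add, mul_add, mul_left_comm, hinv2,
      mul_left_comm, fhat_inversion_deriv]
end

section
/- Let α ∈ (0,1), b > 0 and λ > 0, and let E_α(y) = ∑_{j=0}^∞ y^j / Γ(αj+1) denote the Mittag-Leffler function. Then the integral ∫_0^∞ (e^{−λx} − 1) · α x^{-1} E_α(−x^α / b) dx converges absolutely and equals −ln(1 + b λ^α). Consequently the measure ν(dx) = α x^{-1} E_α(−x^α/b) dx on (0,∞) is the Lévy measure corresponding to the Laplace exponent λ ↦ ln(1 + b λ^α) of the geometric stable subordinator. -/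
open MeasureTheory Real Filter

/-- The Mittag-Leffler function `E_α(y) = ∑_{j=0}^∞ y^j / Γ(αj+1)`. -/
noncomputable def mittagLeffler (α y : ℝ) : ℝ :=
  ∑' j : ℕ, y ^ j / Real.Gamma (α * j + 1)

lemma intervalIntegrable_sub_rpow {r : ℝ} (hr : -1 < r) (x a b : ℝ) :
    IntervalIntegrable (fun t : ℝ => (x - t) ^ r) volume a b := by
  simpa using (intervalIntegral.intervalIntegrable_rpow' (a := x - a) (b := x - b) hr).comp_sub_left x

/-- A continuous solution of the Volterra equation `F = a - c (k * F)`, `k(u) = u ^ (α - 1)`, which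
is positive at the origin stays positive. -/
lemma pos_of_volterra_rpow {F : ℝ → ℝ} {α a c : ℝ} (hα0 : 0 < α) (hα1 : α < 1) (hc : 0 < c)
    (hF : Continuous F) (hF0 : 0 < F 0)
    (hV : ∀ x, 0 ≤ x → F x = a - c * ∫ t in (0 : ℝ)..x, F t * (x - t) ^ (α - 1))
    {x : ℝ} (hx : 0 ≤ x) : 0 < F x := by
  by_contra! hneg
  set S : Set ℝ := {z | 0 ≤ z ∧ F z ≤ 0} with hS
  have hSc : IsClosed S :=
    (isClosed_le continuous_const continuous_id).inter (isClosed_le hF continuous_const)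
  have hSb : BddBelow S := ⟨0, fun z hz => hz.1⟩
  have hSm : sInf S ∈ S := hSc.csInf_mem ⟨x, hx, hneg⟩ hSb
  set x₀ := sInf S
  have hpos : ∀ t, 0 ≤ t → t < x₀ → 0 < F t := by
    intro t ht0 ht
    by_contra! h
    exact absurd (csInf_le hSb (show t ∈ S from ⟨ht0, h⟩)) (not_le.mpr ht)
  have hx₀ : 0 < x₀ := by
    rcases hSm.1.lt_or_eq with h | h
    · exact h
    · have := hSm.2
      rw [← h] at this
      linarith
  obtain ⟨y, ⟨hysmall, hy0⟩, hylt⟩ : ∃ y, (c * ((x₀ - y) ^ α / α) < 1 ∧ 0 < y) ∧ y < x₀ := by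
    have hcont : ContinuousAt (fun y : ℝ => c * ((x₀ - y) ^ α / α)) x₀ := by
      refine ContinuousAt.mul continuousAt_const (ContinuousAt.div_const ?_ _)
      exact ((Real.continuous_rpow_const hα0.le).comp (continuous_const.sub continuous_id)).continuousAt
    have h1 : ∀ᶠ y in nhds x₀, c * ((x₀ - y) ^ α / α) < 1 := by
      refine hcont.eventually_lt continuousAt_const ?_
      simp [Real.zero_rpow hα0.ne']
    have h2 := ((h1.and (lt_mem_nhds hx₀)).filter_mono nhdsWithin_le_nhds).and
      (self_mem_nhdsWithin (a := x₀) (s := Set.Iio x₀))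
    exact h2.exists
  obtain ⟨m, hm, hmax⟩ := isCompact_Icc.exists_isMaxOn (Set.nonempty_Icc.mpr hylt.le)
    (hF.continuousOn (s := Set.Icc y x₀))
  have hFm : 0 < F m := (hpos y hy0.le hylt).trans_le (hmax (Set.left_mem_Icc.mpr hylt.le))
  have hmlt : m < x₀ := by
    rcases hm.2.lt_or_eq with h | h
    · exact h
    · rw [h] at hFm
      exact absurd hSm.2 (not_le.mpr hFm)
  have hm0 : 0 < m := hy0.trans_le hm.1
  have hint : ∀ z p q, IntervalIntegrable (fun t => F t * (z - t) ^ (α - 1)) volume p q :=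
    fun z p q => (intervalIntegrable_sub_rpow (by linarith) z p q).continuousOn_mul hF.continuousOn
  have hsplit := intervalIntegral.integral_add_adjacent_intervals (hint x₀ 0 m) (hint x₀ m x₀)
  have hA : ∫ t in (0 : ℝ)..m, F t * (x₀ - t) ^ (α - 1) ≤
      ∫ t in (0 : ℝ)..m, F t * (m - t) ^ (α - 1) := by
    refine intervalIntegral.integral_mono_on_of_le_Ioo hm0.le (hint _ _ _) (hint _ _ _) ?_
    intro t ht
    refine mul_le_mul_of_nonneg_left ?_ (hpos t ht.1.le (ht.2.trans hmlt)).le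
    exact Real.rpow_le_rpow_of_nonpos (by linarith [ht.2]) (by linarith) (by linarith)
  have hB : ∫ t in m..x₀, F t * (x₀ - t) ^ (α - 1) ≤ ∫ t in m..x₀, F m * (x₀ - t) ^ (α - 1) := by
    refine intervalIntegral.integral_mono_on_of_le_Ioo hmlt.le (hint _ _ _)
      ((intervalIntegrable_sub_rpow (by linarith) _ _ _).const_mul _) ?_
    intro t ht
    exact mul_le_mul_of_nonneg_right (hmax ⟨hm.1.trans ht.1.le, ht.2.le⟩)
      (Real.rpow_nonneg (by linarith [ht.2]) _)
  have hC : ∫ t in m..x₀, F m * (x₀ - t) ^ (α - 1) = F m * ((x₀ - m) ^ α / α) := by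
    rw [intervalIntegral.integral_const_mul,
      intervalIntegral.integral_comp_sub_left (fun u => u ^ (α - 1)),
      integral_rpow (Or.inl (by linarith))]
    simp [Real.zero_rpow hα0.ne']
  have hD : (x₀ - m) ^ α ≤ (x₀ - y) ^ α :=
    Real.rpow_le_rpow (by linarith) (by linarith [hm.1]) hα0.le
  have hE : c * ((x₀ - m) ^ α / α) < 1 := by
    refine lt_of_le_of_lt ?_ hysmall
    gcongr
  have hV₀ := hV x₀ hx₀.le
  have hVm := hV m hm0.le
  have hfin : F m ≤ F m * (c * ((x₀ - m) ^ α / α)) := by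
    have := mul_le_mul_of_nonneg_left hA hc.le
    have := mul_le_mul_of_nonneg_left (hB.trans_eq hC) hc.le
    rw [← hsplit] at hV₀
    linarith [hSm.2]
  nlinarith

lemma rpow_mul_exp_neg_le_Gamma {M s : ℝ} (hM : 0 < M) (hs : 1 ≤ s) :
    M ^ (s - 1) * Real.exp (-M) ≤ Real.Gamma s := by
  rw [Real.Gamma_eq_integral (by linarith), ← integral_exp_neg_Ioi M, ← integral_const_mul]
  have hint := Real.GammaIntegral_convergent (s := s) (by linarith)
  have hsub : Set.Ioi M ⊆ Set.Ioi (0 : ℝ) := Set.Ioi_subset_Ioi hM.le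
  calc ∫ x in Set.Ioi M, M ^ (s - 1) * Real.exp (-x)
      ≤ ∫ x in Set.Ioi M, Real.exp (-x) * x ^ (s - 1) := by
        refine setIntegral_mono_on ((integrableOn_exp_neg_Ioi M).const_mul _) (hint.mono_set hsub)
          measurableSet_Ioi fun x hx => ?_
        rw [mul_comm]
        exact mul_le_mul_of_nonneg_left (Real.rpow_le_rpow hM.le (le_of_lt hx) (by linarith))
          (Real.exp_pos _).le
    _ ≤ _ := by
        refine setIntegral_mono_set hint ?_ hsub.eventuallyLE
        filter_upwards [ae_restrict_mem measurableSet_Ioi] with x hx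
        have : (0 : ℝ) < x := hx
        positivity

lemma Gamma_mul_add_one_pos {α : ℝ} (hα : 0 < α) (j : ℕ) : 0 < Real.Gamma (α * j + 1) :=
  Real.Gamma_pos_of_pos (by positivity)

lemma summable_mittagLeffler {α : ℝ} (hα : 0 < α) {y : ℝ} (hy : 0 ≤ y) :
    Summable fun j : ℕ => y ^ j / Real.Gamma (α * j + 1) := by
  set M : ℝ := (2 * y + 1) ^ α⁻¹
  have hM : 0 < M := by positivity
  have hMα : ∀ j : ℕ, M ^ (α * j + 1 - 1) = (2 * y + 1) ^ j := by
    intro j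
    rw [add_sub_cancel_right, ← Real.rpow_mul (by positivity), inv_mul_cancel_left₀ hα.ne',
      Real.rpow_natCast]
  refine Summable.of_nonneg_of_le
    (fun j => div_nonneg (pow_nonneg hy j) (Gamma_mul_add_one_pos hα j).le) (fun j => ?_)
    (summable_geometric_two.mul_left (Real.exp M))
  have h1 := rpow_mul_exp_neg_le_Gamma hM (s := α * j + 1) (by simp; positivity)
  rw [hMα] at h1
  rw [div_le_iff₀ (Gamma_mul_add_one_pos hα j)]
  calc y ^ j = (1 / 2) ^ j * (2 * y) ^ j := by rw [← mul_pow]; ring_nf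
    _ ≤ (1 / 2) ^ j * (2 * y + 1) ^ j := by gcongr; linarith
    _ = Real.exp M * (1 / 2) ^ j * ((2 * y + 1) ^ j * Real.exp (-M)) := by
      rw [Real.exp_neg]; field_simp
    _ ≤ _ := by gcongr

lemma integral_rpow_mul_sub_rpow {u v x : ℝ} (hu : 0 < u) (hv : 0 < v) (hx : 0 < x) :
    ∫ t in (0 : ℝ)..x, t ^ (u - 1) * (x - t) ^ (v - 1) =
      x ^ (u + v - 1) * (Real.Gamma u * Real.Gamma v / Real.Gamma (u + v)) := by
  have h := Complex.betaIntegral_scaled u v hx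
  rw [Complex.betaIntegral_eq_Gamma_mul_div _ _ (by simpa) (by simpa)] at h
  have hL : ∫ t in (0 : ℝ)..x, (t : ℂ) ^ ((u : ℂ) - 1) * ((x : ℂ) - t) ^ ((v : ℂ) - 1) =
      ((∫ t in (0 : ℝ)..x, t ^ (u - 1) * (x - t) ^ (v - 1) : ℝ) : ℂ) := by
    rw [← intervalIntegral.integral_ofReal]
    refine intervalIntegral.integral_congr fun t ht => ?_
    rw [Set.uIcc_of_le hx.le] at ht
    rw [Complex.ofReal_mul, Complex.ofReal_cpow ht.1, Complex.ofReal_cpow (by linarith [ht.2])]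
    push_cast
    rfl
  rw [hL] at h
  rw [← Complex.ofReal_inj, h, Complex.ofReal_mul, Complex.ofReal_cpow hx.le, ← Complex.ofReal_add,
    Complex.Gamma_ofReal, Complex.Gamma_ofReal, Complex.Gamma_ofReal]
  push_cast
  rfl

lemma continuous_mittagLeffler {α : ℝ} (hα : 0 < α) : Continuous (mittagLeffler α) := by
  rw [continuous_iff_continuousAt]
  intro y
  have hon : ContinuousOn (mittagLeffler α) (Metric.ball 0 (|y| + 1)) := by
    refine continuousOn_tsum (fun j => by fun_prop)
      (summable_mittagLeffler hα (y := |y| + 1) (by positivity)) fun j z hz => ?_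
    have hz' : |z| ≤ |y| + 1 := by simpa using (Metric.mem_ball.mp hz).le
    rw [norm_div, norm_pow, Real.norm_eq_abs, Real.norm_eq_abs,
      abs_of_pos (Gamma_mul_add_one_pos hα j)]
    exact div_le_div_of_nonneg_right (by gcongr) (Gamma_mul_add_one_pos hα j).le
  exact hon.continuousAt (Metric.isOpen_ball.mem_nhds (by simp))

lemma hasSum_mittagLeffler {α : ℝ} (hα : 0 < α) (y : ℝ) :
    HasSum (fun j : ℕ => y ^ j / Real.Gamma (α * j + 1)) (mittagLeffler α y) := by
  refine (Summable.of_norm ?_).hasSum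
  refine (summable_mittagLeffler hα (abs_nonneg y)).congr fun j => ?_
  rw [norm_div, norm_pow, Real.norm_eq_abs, Real.norm_eq_abs,
      abs_of_pos (Gamma_mul_add_one_pos hα j)]

lemma mittagLeffler_zero (α : ℝ) : mittagLeffler α 0 = 1 := by
  rw [mittagLeffler, tsum_eq_single 0 fun j hj => by simp [hj]]
  simp

lemma continuous_mittagLeffler_rpow {α : ℝ} (hα : 0 < α) (b : ℝ) :
    Continuous fun x : ℝ => mittagLeffler α (-(x ^ α) / b) :=
  (continuous_mittagLeffler hα).comp ((Real.continuous_rpow_const hα.le).neg.div_const b)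

lemma integral_mittagLeffler_term {α b x : ℝ} (hα : 0 < α) (hb : 0 < b) (hx : 0 < x) (j : ℕ) :
    ∫ t in (0 : ℝ)..x, (-(t ^ α) / b) ^ j / Real.Gamma (α * j + 1) * (x - t) ^ (α - 1) =
      -(b * Real.Gamma α) *
        ((-(x ^ α) / b) ^ (j + 1) / Real.Gamma (α * (j + 1 : ℕ) + 1)) := by
  have hpow : ∀ {t : ℝ} (n : ℕ), 0 ≤ t → (-(t ^ α) / b) ^ n = (-b⁻¹) ^ n * t ^ (α * n) := by
    intro t n ht
    rw [Real.rpow_mul ht, Real.rpow_natCast, ← mul_pow]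
    ring
  have hcongr : ∫ t in (0 : ℝ)..x, (-(t ^ α) / b) ^ j / Real.Gamma (α * j + 1) * (x - t) ^ (α - 1) =
      ∫ t in (0 : ℝ)..x, (-b⁻¹) ^ j / Real.Gamma (α * j + 1) *
        (t ^ (α * j + 1 - 1) * (x - t) ^ (α - 1)) := by
    refine intervalIntegral.integral_congr fun t ht => ?_
    rw [Set.uIcc_of_le hx.le] at ht
    rw [hpow j ht.1, add_sub_cancel_right]
    ring
  rw [hcongr, intervalIntegral.integral_const_mul,
    integral_rpow_mul_sub_rpow (by positivity) hα hx, hpow (j + 1) hx.le]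
  have e1 : α * j + 1 + α - 1 = α * (j + 1 : ℕ) := by push_cast; ring
  have e2 : α * j + 1 + α = α * (j + 1 : ℕ) + 1 := by push_cast; ring
  rw [e1, e2, pow_succ]
  have h1 := (Gamma_mul_add_one_pos hα j).ne'
  have h2 := (Gamma_mul_add_one_pos hα (j + 1)).ne'
  field_simp

lemma integral_mittagLeffler_mul_sub_rpow {α b x : ℝ} (hα : 0 < α) (hb : 0 < b) (hx : 0 ≤ x) :
    ∫ t in (0 : ℝ)..x, mittagLeffler α (-(t ^ α) / b) * (x - t) ^ (α - 1) =
      b * Real.Gamma α * (1 - mittagLeffler α (-(x ^ α) / b)) := by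
  rcases hx.eq_or_lt with rfl | hx
  · simp [Real.zero_rpow hα.ne', mittagLeffler_zero]
  have hsum : HasSum
      (fun j : ℕ => ∫ t in (0 : ℝ)..x,
        (-(t ^ α) / b) ^ j / Real.Gamma (α * j + 1) * (x - t) ^ (α - 1))
      (∫ t in (0 : ℝ)..x, mittagLeffler α (-(t ^ α) / b) * (x - t) ^ (α - 1)) := by
    have hs := summable_mittagLeffler hα (y := x ^ α / b) (by positivity)
    refine intervalIntegral.hasSum_integral_of_dominated_convergence
      (fun j t => (x ^ α / b) ^ j / Real.Gamma (α * j + 1) * (x - t) ^ (α - 1)) ?_ ?_ ?_ ?_ ?_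
    · intro j
      refine Measurable.aestronglyMeasurable ?_
      fun_prop
    · intro j
      refine Eventually.of_forall fun t ht => ?_
      rw [Set.uIoc_of_le hx.le] at ht
      have hxt : (0 : ℝ) ≤ (x - t) ^ (α - 1) := Real.rpow_nonneg (by linarith [ht.2]) _
      rw [norm_mul, norm_div, norm_pow, norm_div, norm_neg, Real.norm_of_nonneg hxt,
        Real.norm_of_nonneg (Real.rpow_nonneg ht.1.le _), Real.norm_of_nonneg hb.le,
        Real.norm_of_nonneg (Gamma_mul_add_one_pos hα j).le]
      have := Gamma_mul_add_one_pos hα j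
      have := Real.rpow_nonneg ht.1.le α
      have := Real.rpow_le_rpow ht.1.le ht.2 hα.le
      gcongr
    · exact Eventually.of_forall fun t _ => hs.mul_right _
    · simp_rw [tsum_mul_right]
      exact (intervalIntegrable_sub_rpow (by linarith) _ _ _).const_mul _
    · exact Eventually.of_forall fun t _ => (hasSum_mittagLeffler hα _).mul_right _
  have hshift := ((hasSum_nat_add_iff' 1).mpr (hasSum_mittagLeffler hα (-(x ^ α) / b))).mul_left
    (-(b * Real.Gamma α))
  simp_rw [integral_mittagLeffler_term hα hb hx] at hsum
  rw [hsum.unique hshift]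
  simp
  ring

lemma mittagLeffler_pos {α b x : ℝ} (hα0 : 0 < α) (hα1 : α < 1) (hb : 0 < b) (hx : 0 ≤ x) :
    0 < mittagLeffler α (-(x ^ α) / b) := by
  have hΓ := Real.Gamma_pos_of_pos hα0
  refine pos_of_volterra_rpow (F := fun x => mittagLeffler α (-(x ^ α) / b)) (a := 1)
    (c := (b * Real.Gamma α)⁻¹) hα0 hα1 (by positivity) (continuous_mittagLeffler_rpow hα0 b) ?_
    (fun z hz => ?_) hx
  · simp [Real.zero_rpow hα0.ne', mittagLeffler_zero]
  · rw [integral_mittagLeffler_mul_sub_rpow hα0 hb hz]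
    field_simp
    ring

lemma mittagLeffler_le_one {α b x : ℝ} (hα0 : 0 < α) (hα1 : α < 1) (hb : 0 < b) (hx : 0 ≤ x) :
    mittagLeffler α (-(x ^ α) / b) ≤ 1 := by
  have hΓ := Real.Gamma_pos_of_pos hα0
  have h : 0 ≤ ∫ t in (0 : ℝ)..x, mittagLeffler α (-(t ^ α) / b) * (x - t) ^ (α - 1) :=
    intervalIntegral.integral_nonneg hx fun t ht =>
      mul_nonneg (mittagLeffler_pos hα0 hα1 hb ht.1).le (Real.rpow_nonneg (by linarith [ht.2]) _)
  rw [integral_mittagLeffler_mul_sub_rpow hα0 hb hx] at h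
  linarith [nonneg_of_mul_nonneg_right h (by positivity)]

lemma integrableOn_exp_neg_mul_mittagLeffler {α b s : ℝ} (hα0 : 0 < α) (hα1 : α < 1) (hb : 0 < b)
    (hs : 0 < s) :
    IntegrableOn (fun x : ℝ => Real.exp (-(s * x)) * mittagLeffler α (-(x ^ α) / b))
      (Set.Ioi 0) := by
  have hexp : IntegrableOn (fun x : ℝ => Real.exp (-(s * x))) (Set.Ioi 0) := by
    simpa using integrableOn_exp_mul_Ioi (neg_lt_zero.mpr hs) 0
  have hF := continuous_mittagLeffler_rpow hα0 b
  refine Integrable.mono' hexp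
    (Continuous.aestronglyMeasurable (by fun_prop)) ?_
  filter_upwards [ae_restrict_mem measurableSet_Ioi] with x hx
  have hx0 : (0 : ℝ) ≤ x := le_of_lt hx
  rw [norm_mul, Real.norm_of_nonneg (Real.exp_pos _).le,
    Real.norm_of_nonneg (mittagLeffler_pos hα0 hα1 hb hx0).le]
  exact mul_le_of_le_one_right (Real.exp_pos _).le (mittagLeffler_le_one hα0 hα1 hb hx0)

/-- The Laplace transform of `x ↦ E_α(-x^α / b)`. -/
lemma integral_exp_neg_mul_mittagLeffler {α b s : ℝ} (hα0 : 0 < α) (hα1 : α < 1) (hb : 0 < b)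
    (hs : 0 < s) :
    ∫ x in Set.Ioi (0 : ℝ), Real.exp (-(s * x)) * mittagLeffler α (-(x ^ α) / b) =
      b * s ^ (α - 1) / (1 + b * s ^ α) := by
  have hΓ := Real.Gamma_pos_of_pos hα0
  have hf := integrableOn_exp_neg_mul_mittagLeffler hα0 hα1 hb hs
  have hexp : IntegrableOn (fun x : ℝ => Real.exp (-(s * x))) (Set.Ioi 0) := by
    simpa using integrableOn_exp_mul_Ioi (neg_lt_zero.mpr hs) 0
  have hexpI : ∫ x in Set.Ioi (0 : ℝ), Real.exp (-(s * x)) = s⁻¹ := by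
    have := integral_exp_mul_Ioi (neg_lt_zero.mpr hs) 0
    simpa [neg_mul] using this
  have hg : IntegrableOn (fun u : ℝ => u ^ (α - 1) * Real.exp (-(s * u))) (Set.Ioi 0) := by
    simpa using integrableOn_rpow_mul_exp_neg_mul_rpow (p := 1) (s := α - 1) (by linarith)
      one_pos hs
  have hconv := integral_posConvolution hf hg (ContinuousLinearMap.mul ℝ ℝ)
  simp only [ContinuousLinearMap.mul_apply'] at hconv
  rw [Real.integral_rpow_mul_exp_neg_mul_Ioi hα0 hs] at hconv
  have hL : ∫ x in Set.Ioi (0 : ℝ), ∫ t in (0 : ℝ)..x,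
      Real.exp (-(s * t)) * mittagLeffler α (-(t ^ α) / b) *
        ((x - t) ^ (α - 1) * Real.exp (-(s * (x - t)))) =
      ∫ x in Set.Ioi (0 : ℝ), b * Real.Gamma α * (Real.exp (-(s * x)) -
        Real.exp (-(s * x)) * mittagLeffler α (-(x ^ α) / b)) := by
    refine setIntegral_congr_fun measurableSet_Ioi fun x hx => ?_
    have hx0 : (0 : ℝ) ≤ x := le_of_lt hx
    calc _ = ∫ t in (0 : ℝ)..x, Real.exp (-(s * x)) *
          (mittagLeffler α (-(t ^ α) / b) * (x - t) ^ (α - 1)) := by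
          refine intervalIntegral.integral_congr fun t _ => ?_
          have : Real.exp (-(s * x)) = Real.exp (-(s * t)) * Real.exp (-(s * (x - t))) := by
            rw [← Real.exp_add]
            ring_nf
          simp only [this]
          ring
      _ = _ := by
          rw [intervalIntegral.integral_const_mul, integral_mittagLeffler_mul_sub_rpow hα0 hb hx0]
          ring
  rw [hL, integral_const_mul, integral_sub hexp hf, hexpI] at hconv
  set L := ∫ x in Set.Ioi (0 : ℝ), Real.exp (-(s * x)) * mittagLeffler α (-(x ^ α) / b)
  have hsα : 0 < s ^ α := by positivity
  rw [one_div, Real.inv_rpow hs.le] at hconv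
  rw [Real.rpow_sub_one hs.ne', eq_div_iff (by positivity)]
  field_simp at hconv ⊢
  linarith

lemma integral_mul_rpow_div {α b l : ℝ} (hα : 0 < α) (hb : 0 < b) (hl : 0 < l) :
    IntervalIntegrable (fun s : ℝ => α * (b * s ^ (α - 1) / (1 + b * s ^ α))) volume 0 l ∧
    ∫ s in (0 : ℝ)..l, α * (b * s ^ (α - 1) / (1 + b * s ^ α)) = Real.log (1 + b * l ^ α) := by
  have hrpow : ContinuousOn (fun s : ℝ => s ^ α) (Set.Icc 0 l) :=
    (Real.continuous_rpow_const hα.le).continuousOn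
  have hpos : ∀ s ∈ Set.Icc (0 : ℝ) l, 1 + b * s ^ α ≠ 0 := by
    intro s hs
    have := Real.rpow_nonneg hs.1 α
    positivity
  have hint : IntervalIntegrable (fun s : ℝ => α * (b * s ^ (α - 1) / (1 + b * s ^ α)))
      volume 0 l := by
    have h1 : IntervalIntegrable (fun s : ℝ => s ^ (α - 1)) volume 0 l :=
      intervalIntegral.intervalIntegrable_rpow' (by linarith)
    have h2 : ContinuousOn (fun s : ℝ => α * b / (1 + b * s ^ α)) (Set.uIcc 0 l) := by
      rw [Set.uIcc_of_le hl.le]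
      exact continuousOn_const.div (continuousOn_const.add (continuousOn_const.mul hrpow)) hpos
    refine (h1.continuousOn_mul h2).congr fun s _ => ?_
    ring
  refine ⟨hint, ?_⟩
  have hcont : ContinuousOn (fun s : ℝ => Real.log (1 + b * s ^ α)) (Set.Icc 0 l) :=
    (continuousOn_const.add (continuousOn_const.mul hrpow)).log hpos
  rw [intervalIntegral.integral_eq_sub_of_hasDerivAt_of_le hl.le hcont (fun s hs => ?_) hint]
  · simp [Real.zero_rpow hα.ne']
  · have hd := (((Real.hasDerivAt_rpow_const (p := α) (Or.inl hs.1.ne')).const_mul b).const_add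
      1).log (hpos s ⟨hs.1.le, hs.2.le⟩)
    exact hd.congr_deriv (by ring)

theorem stmt10 (α b lam : ℝ) (hα : α ∈ Set.Ioo (0 : ℝ) 1) (hb : 0 < b)
    (hlam : 0 < lam) :
    IntegrableOn (fun x : ℝ =>
      (Real.exp (-(lam * x)) - 1) * (α * x⁻¹ * mittagLeffler α (-(x ^ α) / b)))
      (Set.Ioi 0) volume ∧
    (∫ x : ℝ in Set.Ioi 0,
        (Real.exp (-(lam * x)) - 1) * (α * x⁻¹ * mittagLeffler α (-(x ^ α) / b)))
      = -Real.log (1 + b * lam ^ α) := by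
  obtain ⟨hα0, hα1⟩ := hα
  obtain ⟨hint, hlog⟩ := integral_mul_rpow_div hα0 hb hlam
  rw [intervalIntegrable_iff_integrableOn_Ioc_of_le hlam.le] at hint
  rw [intervalIntegral.integral_of_le hlam.le] at hlog
  set G : ℝ → ℝ → ℝ := fun s x => α * (Real.exp (-(s * x)) * mittagLeffler α (-(x ^ α) / b))
    with hG
  have hF := continuous_mittagLeffler_rpow hα0 b
  have hGi : ∀ s ∈ Set.Ioc 0 lam, ∫ x in Set.Ioi 0, G s x =
      α * (b * s ^ (α - 1) / (1 + b * s ^ α)) := fun s hs => by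
    rw [integral_const_mul, integral_exp_neg_mul_mittagLeffler hα0 hα1 hb hs.1]
  have hprod : Integrable (Function.uncurry G)
      ((volume.restrict (Set.Ioc 0 lam)).prod (volume.restrict (Set.Ioi 0))) := by
    rw [integrable_prod_iff]
    · refine ⟨?_, hint.congr ?_⟩
      · filter_upwards [ae_restrict_mem measurableSet_Ioc] with s hs
        exact (integrableOn_exp_neg_mul_mittagLeffler hα0 hα1 hb hs.1).const_mul α
      · filter_upwards [ae_restrict_mem measurableSet_Ioc] with s hs
        rw [← hGi s hs]
        refine setIntegral_congr_fun measurableSet_Ioi fun x hx => ?_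
        have := mittagLeffler_pos hα0 hα1 hb (le_of_lt hx)
        exact (Real.norm_of_nonneg (by simp only [hG]; positivity)).symm
    · refine Continuous.aestronglyMeasurable ?_
      have := hF.comp (continuous_snd (X := ℝ) (Y := ℝ))
      simp only [Function.uncurry_def, hG]
      exact continuous_const.mul (Continuous.mul (by fun_prop) this)
  have hGx : ∀ x ∈ Set.Ioi (0 : ℝ), -∫ s in Set.Ioc 0 lam, G s x =
      (Real.exp (-(lam * x)) - 1) * (α * x⁻¹ * mittagLeffler α (-(x ^ α) / b)) := by
    intro x hx
    have hx0 : x ≠ 0 := ne_of_gt hx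
    have hI : ∫ s in (0 : ℝ)..lam, Real.exp (-(s * x)) = (1 - Real.exp (-(lam * x))) * x⁻¹ := by
      have hd : ∀ s ∈ Set.uIcc 0 lam,
          HasDerivAt (fun s => -Real.exp (-(s * x)) * x⁻¹) (Real.exp (-(s * x))) s := by
        intro s _
        have := ((((hasDerivAt_id s).mul_const x).neg.exp).neg).mul_const x⁻¹
        refine this.congr_deriv ?_
        simp [hx0]
      rw [intervalIntegral.integral_eq_sub_of_hasDerivAt hd
        (Continuous.intervalIntegrable (by fun_prop) _ _)]
      simp
      ring
    rw [← intervalIntegral.integral_of_le hlam.le, hG]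
    simp only
    rw [intervalIntegral.integral_const_mul, intervalIntegral.integral_mul_const, hI]
    ring
  constructor
  · refine Integrable.congr hprod.integral_prod_right.neg ?_
    filter_upwards [ae_restrict_mem measurableSet_Ioi] with x hx
    exact hGx x hx
  · rw [← setIntegral_congr_fun measurableSet_Ioi hGx, integral_neg,
      ← integral_integral_swap hprod, setIntegral_congr_fun measurableSet_Ioc hGi, hlog]
end
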